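/- arXiv:0710.2101 — 5 statements merged into one kernel-verified Lean document; each statement's English description precedes it below -/
import Mathlib

section
/- Let W be any type and let S₀, S₁, S₂, S₃ : ℤ × ℤ × ℤ → W be functions such that S₀(a,b,c) = S₀(b,c,a) and S₃(a,b,c) = S₃(b,c,a) for all a,b,c ∈ ℤ. Then the following two conditions are equivalent: (1) for all a,b,c ∈ ℤ one has S₁(a,b,c) = S₂(a,b,c), S₁(c,a,b) = S₂(b,c,a), S₂(c,a,b) = S₃(a,b+1,c), and S₀(a,b,c) = S₁(b+1,c,a); (2) for all a,b,c ∈ ℤ, writing k = a+b+c, one has S₀(a,b,c) = S₁(k+1,0,0), S₁(a,b,c) = S₁(k,0,0), S₂(a,b,c) = S₁(k,0,0), and S₃(a,b,c) = S₁(k−1,0,0). -/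
noncomputable section

/-- A function of two integers that is unchanged when a unit is moved from one argument to the
other depends only on the sum of its arguments. -/
theorem eq_add_zero_of_unit_shift {W : Type*} {g : ℤ → ℤ → W}
    (hg : ∀ x y, g (x + 1) y = g x (y + 1)) (x y : ℤ) : g x y = g (x + y) 0 := by
  induction y using Int.induction_on generalizing x with
  | zero => rw [add_zero]
  | succ n ih => rw [← hg, ih, add_right_comm, add_assoc]
  | pred n ih =>
    have h := hg (x - 1) (-n - 1)
    rw [sub_add_cancel, sub_add_cancel, ih] at h
    rw [h]
    congr 1
    ring

/-- A cyclically invariant function of three integers that is unchanged when a unit is moved from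
the first argument to the second depends only on the sum of its arguments. -/
theorem eq_sum_zero_zero_of_cyclic_of_unit_shift {W : Type*} {f : ℤ × ℤ × ℤ → W}
    (hcyc : ∀ x y z, f (x, y, z) = f (z, x, y))
    (hshift : ∀ x y z, f (x + 1, y, z) = f (x, y + 1, z)) (x y z : ℤ) :
    f (x, y, z) = f (x + y + z, 0, 0) := by
  have merge : ∀ x y z, f (x, y, z) = f (x + y, 0, z) := fun x y z =>
    eq_add_zero_of_unit_shift (g := fun x y => f (x, y, z)) (fun x y => hshift x y z) x y
  rw [merge, hcyc, merge, add_comm z]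

theorem stmt0 {W : Type*} (S0 S1 S2 S3 : ℤ × ℤ × ℤ → W)
    (hS0 : ∀ a b c : ℤ, S0 (a, b, c) = S0 (b, c, a))
    (hS3 : ∀ a b c : ℤ, S3 (a, b, c) = S3 (b, c, a)) :
    (∀ a b c : ℤ,
      S1 (a, b, c) = S2 (a, b, c) ∧
      S1 (c, a, b) = S2 (b, c, a) ∧
      S2 (c, a, b) = S3 (a, b + 1, c) ∧
      S0 (a, b, c) = S1 (b + 1, c, a)) ↔
    (∀ a b c : ℤ,
      S0 (a, b, c) = S1 (a + b + c + 1, 0, 0) ∧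
      S1 (a, b, c) = S1 (a + b + c, 0, 0) ∧
      S2 (a, b, c) = S1 (a + b + c, 0, 0) ∧
      S3 (a, b, c) = S1 (a + b + c - 1, 0, 0)) := by
  constructor
  · intro h
    have hcyc : ∀ x y z, S1 (x, y, z) = S1 (z, x, y) := fun x y z =>
      (h y z x).2.1.trans (h z x y).1.symm
    have hshift : ∀ x y z, S1 (x + 1, y, z) = S1 (x, y + 1, z) := fun x y z => by
      rw [← (h z x y).2.2.2, hS0, (h x y z).2.2.2, hcyc]
    have hsum := eq_sum_zero_zero_of_cyclic_of_unit_shift hcyc hshift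
    intro a b c
    refine ⟨?_, hsum a b c, (h a b c).1.symm.trans (hsum a b c), ?_⟩
    · rw [(h a b c).2.2.2, hsum]
      congr 2
      ring
    · have h3 := (h a (b - 1) c).2.2.1
      rw [sub_add_cancel] at h3
      rw [← h3, ← (h c a (b - 1)).1, hsum]
      congr 2
      ring
  · intro h a b c
    refine ⟨?_, ?_, ?_, ?_⟩
    · rw [(h a b c).2.1, (h a b c).2.2.1]
    · rw [(h c a b).2.1, (h b c a).2.2.1]
      congr 2
      ring
    · rw [(h c a b).2.2.1, (h a (b + 1) c).2.2.2]
      congr 2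
      ring
    · rw [(h a b c).1, (h (b + 1) c a).2.1]
      congr 2
      ring
end
end

section
/- Let W be a ℚ-vector space, let Jp, JA, JB : ℤ × ℤ → W and S₀, S₁, S₂, S₃ : ℤ × ℤ × ℤ → W be functions satisfying, for all a,b,c ∈ ℤ: Jp(a,b) = Jp(b,a); S₀(a,b,c) = S₀(b,c,a); S₃(a,b,c) = S₃(b,c,a); JB(a,b) = JA(a−1,b−1); S₁(a,b,c) − S₂(a,b,c) = Jp(c+a−1,b) − Jp(c+a+1,b); S₁(c,a,b) − S₂(b,c,a) = Jp(c+a−1,b) − Jp(c+a+1,b); S₂(c,a,b) − S₃(a,b+1,c) = JA(c+a−2,b) − JA(c+a,b); and S₀(a,b,c) − S₁(b+1,c,a) = JA(c+a−1,b) − JA(c+a+1,b). Then for all a,b,c ∈ ℤ, each of the values JB(a,b), S₀(a,b,c), S₁(a,b,c), S₂(a,b,c), S₃(a,b,c) lies in the ℚ-submodule of W spanned by the set {Jp(x,y) : x,y ∈ ℤ} ∪ {JA(x,y) : x,y ∈ ℤ} ∪ {S₁(k,0,0) : k ∈ ℤ}. -/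
noncomputable section

/-- A function on `ℤ` that does not change under a unit shift is constant. -/
theorem eq_apply_zero_of_forall_apply_add_one {X : Type*} {g : ℤ → X}
    (hg : ∀ n, g (n + 1) = g n) (n : ℤ) : g n = g 0 := by
  have hper : Function.Periodic g 1 := hg
  simpa using hper.int_mul_eq n

/-- A cyclically invariant function on integer triples that allows a unit to move from the third
entry to the second depends only on the sum of the entries. -/
theorem eq_apply_sum_of_cyclic_of_shift {X : Type*} {f : ℤ → ℤ → ℤ → X}
    (hcyc : ∀ a b c, f a b c = f b c a) (hshift : ∀ a b c, f a (b + 1) c = f a b (c + 1))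
    (a b c : ℤ) : f a b c = f (a + b + c) 0 0 := by
  have move_third (a b c : ℤ) : f a b c = f a (b + c) 0 := by
    have h := eq_apply_zero_of_forall_apply_add_one (g := fun n => f a (b + c - n) n)
      (fun n => by
        rw [← hshift]
        congr 1
        ring) c
    simpa using h
  rw [move_third a b c, ← hcyc, move_third, hcyc, add_assoc]

theorem stmt1 {W : Type*} [AddCommGroup W] [Module ℚ W]
    (Jp JA JB : ℤ × ℤ → W) (S0 S1 S2 S3 : ℤ × ℤ × ℤ → W)
    (hJp : ∀ a b : ℤ, Jp (a, b) = Jp (b, a))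
    (hS0 : ∀ a b c : ℤ, S0 (a, b, c) = S0 (b, c, a))
    (hS3 : ∀ a b c : ℤ, S3 (a, b, c) = S3 (b, c, a))
    (hJB : ∀ a b : ℤ, JB (a, b) = JA (a - 1, b - 1))
    (h1 : ∀ a b c : ℤ, S1 (a, b, c) - S2 (a, b, c) = Jp (c + a - 1, b) - Jp (c + a + 1, b))
    (h2 : ∀ a b c : ℤ, S1 (c, a, b) - S2 (b, c, a) = Jp (c + a - 1, b) - Jp (c + a + 1, b))
    (h3 : ∀ a b c : ℤ, S2 (c, a, b) - S3 (a, b + 1, c) = JA (c + a - 2, b) - JA (c + a, b))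
    (h4 : ∀ a b c : ℤ, S0 (a, b, c) - S1 (b + 1, c, a) = JA (c + a - 1, b) - JA (c + a + 1, b)) :
    ∀ a b c : ℤ,
      JB (a, b) ∈ Submodule.span ℚ
        (Set.range Jp ∪ Set.range JA ∪ Set.range (fun k : ℤ => S1 (k, 0, 0))) ∧
      S0 (a, b, c) ∈ Submodule.span ℚ
        (Set.range Jp ∪ Set.range JA ∪ Set.range (fun k : ℤ => S1 (k, 0, 0))) ∧
      S1 (a, b, c) ∈ Submodule.span ℚ
        (Set.range Jp ∪ Set.range JA ∪ Set.range (fun k : ℤ => S1 (k, 0, 0))) ∧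
      S2 (a, b, c) ∈ Submodule.span ℚ
        (Set.range Jp ∪ Set.range JA ∪ Set.range (fun k : ℤ => S1 (k, 0, 0))) ∧
      S3 (a, b, c) ∈ Submodule.span ℚ
        (Set.range Jp ∪ Set.range JA ∪ Set.range (fun k : ℤ => S1 (k, 0, 0))) := by
  set M := Submodule.span ℚ
    (Set.range Jp ∪ Set.range JA ∪ Set.range (fun k : ℤ => S1 (k, 0, 0)))
  have memJp (p : ℤ × ℤ) : Jp p ∈ M := Submodule.subset_span (.inl (.inl ⟨p, rfl⟩))
  have memJA (p : ℤ × ℤ) : JA p ∈ M := Submodule.subset_span (.inl (.inr ⟨p, rfl⟩))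
  have memS1 (k : ℤ) : S1 (k, 0, 0) ∈ M := Submodule.subset_span (.inr ⟨k, rfl⟩)
  have congr_of_sub {x y u v : W} (h : x - y = u - v) (hu : u ∈ M) (hv : v ∈ M) :
      M.mkQ x = M.mkQ y :=
    (Submodule.Quotient.eq M).2 (h ▸ M.sub_mem hu hv)
  have q12 (a b c : ℤ) : M.mkQ (S1 (a, b, c)) = M.mkQ (S2 (a, b, c)) :=
    congr_of_sub (h1 a b c) (memJp _) (memJp _)
  have q23 (a b c : ℤ) : M.mkQ (S2 (c, a, b)) = M.mkQ (S3 (a, b + 1, c)) :=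
    congr_of_sub (h3 a b c) (memJA _) (memJA _)
  have q01 (a b c : ℤ) : M.mkQ (S0 (a, b, c)) = M.mkQ (S1 (b + 1, c, a)) :=
    congr_of_sub (h4 a b c) (memJA _) (memJA _)
  have cyc (a b c : ℤ) : M.mkQ (S1 (a, b, c)) = M.mkQ (S1 (b, c, a)) := by
    rw [q12 a b c]
    exact (congr_of_sub (h2 c a b) (memJp _) (memJp _)).symm
  have shift (a b c : ℤ) : M.mkQ (S1 (a, b + 1, c)) = M.mkQ (S1 (a, b, c + 1)) := by
    rw [cyc, ← q01, hS0, q01, cyc]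
  have mem1 (a b c : ℤ) : S1 (a, b, c) ∈ M := by
    rw [← Submodule.Quotient.mk_eq_zero M, ← Submodule.mkQ_apply,
      eq_apply_sum_of_cyclic_of_shift (f := fun a b c => M.mkQ (S1 (a, b, c))) cyc shift]
    exact (Submodule.Quotient.mk_eq_zero M).2 (memS1 _)
  have mem_of_congr {x y : W} (h : M.mkQ x = M.mkQ y) (hx : x ∈ M) : y ∈ M := by
    rw [← Submodule.Quotient.mk_eq_zero M] at hx ⊢
    exact h.symm.trans hx
  have mem2 (a b c : ℤ) : S2 (a, b, c) ∈ M := mem_of_congr (q12 a b c) (mem1 a b c)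
  intro a b c
  refine ⟨hJB a b ▸ memJA _, mem_of_congr (q01 a b c).symm (mem1 _ _ _), mem1 a b c,
    mem2 a b c, ?_⟩
  simpa using mem_of_congr (q23 a (b - 1) c) (mem2 _ _ _)
end
end

section
/- For every i ∈ {1,…,6} and every (a,b) ∈ ℤ², one has ψᵢ(Z_{a,b}) = 0. -/
noncomputable section

abbrev Xsp : Type := (ℤ × ℤ) →₀ ℚ
abbrev Ysp : Type := ℤ →₀ ℚ
abbrev V : Type := Xsp × Ysp

/-- The basis vector `X_{a,b}` of `V`. -/
def XB (a b : ℤ) : V := (Finsupp.single (a, b) 1, 0)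

/-- The basis vector `Y_d` of `V`. -/
def YB (d : ℤ) : V := (0, Finsupp.single d 1)

/-- The linear map `V → ℚ` determined on the basis by `X_{a,b} ↦ gX (a,b)`, `Y_d ↦ gY d`. -/
def lmap (gX : ℤ × ℤ → ℚ) (gY : ℤ → ℚ) : V →ₗ[ℚ] ℚ :=
  (Finsupp.linearCombination ℚ gX).comp (LinearMap.fst ℚ Xsp Ysp)
  + (Finsupp.linearCombination ℚ gY).comp (LinearMap.snd ℚ Xsp Ysp)

/-- `ψ₁ : Y_d ↦ 1` for `d` odd, `X_{a,b} ↦ -1` for `a+b` odd, all else to `0`. -/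
def psi1 : V →ₗ[ℚ] ℚ :=
  lmap (fun p => if Odd (p.1 + p.2) then -1 else 0) (fun d => if Odd d then 1 else 0)

/-- `ψ₂ : Y_d ↦ 1` for `d` even, `X_{a,b} ↦ -1` for `a+b` even, all else to `0`. -/
def psi2 : V →ₗ[ℚ] ℚ :=
  lmap (fun p => if Even (p.1 + p.2) then -1 else 0) (fun d => if Even d then 1 else 0)

/-- `ψ₃ : Y_d ↦ d` for `d` odd, `X_{a,b} ↦ -(a+b)` for `a+b` odd, all else to `0`. -/
def psi3 : V →ₗ[ℚ] ℚ :=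
  lmap (fun p => if Odd (p.1 + p.2) then -((p.1 : ℚ) + p.2) else 0)
    (fun d => if Odd d then (d : ℚ) else 0)

/-- `ψ₄ : Y_d ↦ d` for `d` even, `X_{a,b} ↦ -(a+b)` for `a+b` even, all else to `0`. -/
def psi4 : V →ₗ[ℚ] ℚ :=
  lmap (fun p => if Even (p.1 + p.2) then -((p.1 : ℚ) + p.2) else 0)
    (fun d => if Even d then (d : ℚ) else 0)

/-- `ψ₅ : Y_d ↦ 1/d` for `d` odd,
`X_{a,b} ↦ (4(a-b+1) - (a+b)²)/((a+b)((a+b)²-4))` for `a+b` odd, all else to `0`. -/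
def psi5 : V →ₗ[ℚ] ℚ :=
  lmap
    (fun p => if Odd (p.1 + p.2) then
        (4 * ((p.1 : ℚ) - p.2 + 1) - ((p.1 : ℚ) + p.2) ^ 2) /
          (((p.1 : ℚ) + p.2) * (((p.1 : ℚ) + p.2) ^ 2 - 4))
      else 0)
    (fun d => if Odd d then 1 / (d : ℚ) else 0)

/-- `ψ₆ : Y₀ ↦ 1`, `X_{a,b} ↦ b-a-1` for `a+b = 0`, `X_{a,b} ↦ (a-b)/2` for `a+b = ±2`,
all else to `0`. -/
def psi6 : V →ₗ[ℚ] ℚ :=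
  lmap
    (fun p => if p.1 + p.2 = 0 then (p.2 : ℚ) - p.1 - 1
      else if p.1 + p.2 = 2 ∨ p.1 + p.2 = -2 then ((p.1 : ℚ) - p.2) / 2 else 0)
    (fun d => if d = 0 then 1 else 0)

/-- The six linear maps `ψ₁, …, ψ₆`. -/
def psi : Fin 6 → (V →ₗ[ℚ] ℚ) := ![psi1, psi2, psi3, psi4, psi5, psi6]

/-- `Φ_{a,b} = ((a-b)/2)·Y_{a+b-2} + (b-a-1)·Y_{a+b} + ((a-b)/2)·Y_{a+b+2}`. -/
def Phi (a b : ℤ) : V :=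
  (((a : ℚ) - b) / 2) • YB (a + b - 2) + ((b : ℚ) - a - 1) • YB (a + b)
    + (((a : ℚ) - b) / 2) • YB (a + b + 2)

/-- `Z_{a,b} = X_{a,b} - Φ_{a,b}`. -/
def Z (a b : ℤ) : V := XB a b - Phi a b

theorem lmap_Z (gX : ℤ × ℤ → ℚ) (gY : ℤ → ℚ) (a b : ℤ) :
    lmap gX gY (Z a b) = gX (a, b) - (((a : ℚ) - b) / 2 * gY (a + b - 2)
      + ((b : ℚ) - a - 1) * gY (a + b) + ((a : ℚ) - b) / 2 * gY (a + b + 2)) := by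
  have hX : lmap gX gY (XB a b) = gX (a, b) := by simp [lmap, XB]
  have hY (d : ℤ) : lmap gX gY (YB d) = gY d := by simp [lmap, YB]
  simp only [Z, Phi, map_sub, map_add, map_smul, hX, hY, smul_eq_mul]

theorem odd_sub_two_iff (s : ℤ) : Odd (s - 2) ↔ Odd s := by
  simp

theorem odd_add_two_iff (s : ℤ) : Odd (s + 2) ↔ Odd s := by
  simp

theorem even_sub_two_iff (s : ℤ) : Even (s - 2) ↔ Even s := by
  simp

theorem even_add_two_iff (s : ℤ) : Even (s + 2) ↔ Even s := by
  simp

theorem psi1_Z (a b : ℤ) : psi1 (Z a b) = 0 := by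
  rw [psi1, lmap_Z]
  simp only [odd_sub_two_iff, odd_add_two_iff]
  split_ifs <;> ring

theorem psi2_Z (a b : ℤ) : psi2 (Z a b) = 0 := by
  rw [psi2, lmap_Z]
  simp only [even_sub_two_iff, even_add_two_iff]
  split_ifs <;> ring

theorem psi3_Z (a b : ℤ) : psi3 (Z a b) = 0 := by
  rw [psi3, lmap_Z]
  simp only [odd_sub_two_iff, odd_add_two_iff]
  split_ifs <;> push_cast <;> ring

theorem psi4_Z (a b : ℤ) : psi4 (Z a b) = 0 := by
  rw [psi4, lmap_Z]
  simp only [even_sub_two_iff, even_add_two_iff]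
  split_ifs <;> push_cast <;> ring

theorem psi5_Z (a b : ℤ) : psi5 (Z a b) = 0 := by
  rw [psi5, lmap_Z]
  simp only [odd_sub_two_iff, odd_add_two_iff]
  split_ifs with h
  · have h0 : (a : ℚ) + b ≠ 0 := by
      have : a + b ≠ 0 := by grind
      exact_mod_cast this
    have h1 : (a : ℚ) + b - 2 ≠ 0 := by
      have : a + b - 2 ≠ 0 := by grind
      exact_mod_cast this
    have h2 : (a : ℚ) + b + 2 ≠ 0 := by
      have : a + b + 2 ≠ 0 := by grind
      exact_mod_cast this
    have hfac : ((a : ℚ) + b) ^ 2 - 4 = (a + b - 2) * (a + b + 2) := by ring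
    push_cast
    rw [hfac]
    field_simp
    ring
  · ring

theorem psi6_Z (a b : ℤ) : psi6 (Z a b) = 0 := by
  rw [psi6, lmap_Z]
  dsimp only
  split_ifs <;> first | omega | ring

theorem stmt2 : ∀ i : Fin 6, ∀ a b : ℤ, psi i (Z a b) = 0 := by
  intro i a b
  fin_cases i
  · exact psi1_Z a b
  · exact psi2_Z a b
  · exact psi3_Z a b
  · exact psi4_Z a b
  · exact psi5_Z a b
  · exact psi6_Z a b
end
end

section
/- The family {vJ⁺(a,b) : (a,b) ∈ ℤ², a ≥ b} ∪ {vJᴬ(a,b) : (a,b) ∈ ℤ², a ≥ b} is linearly independent in V, and its ℚ-linear span equals the ℚ-linear span of {Z_{a,b} : (a,b) ∈ ℤ²}. -/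
noncomputable section

/-- `vJ⁺(a,b) = X_{a,b} + X_{b,a} + 2·Y_{a+b}`, the value `F⁽¹⁾(J⁺_{a,b})`. -/
def vJp (a b : ℤ) : V := XB a b + XB b a + (2 : ℚ) • YB (a + b)

/-- `vJᴬ(a,b) = X_{a,b+1} + X_{b,a+1} + Y_{a+b-1} + Y_{a+b+3}`, the value `F⁽¹⁾(J^A_{a,b})`. -/
def vJA (a b : ℤ) : V := XB a (b + 1) + XB b (a + 1) + YB (a + b - 1) + YB (a + b + 3)

/-- The index of the second summand of the generator whose leading term is `Z p`. -/
def partner (p : ℤ × ℤ) : ℤ × ℤ :=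
  if p.2 ≤ p.1 then (p.2, p.1) else (p.2 - 1, p.1 + 1)

/-- The rank of `p` in the chain of indices linked by `partner`. -/
def depth (p : ℤ × ℤ) : ℕ :=
  if p.2 ≤ p.1 then (p.1 - p.2).toNat else (p.2 - p.1 - 1).toNat

theorem depth_partner_lt {p : ℤ × ℤ} (hp : partner p ≠ p) : depth (partner p) < depth p := by
  obtain ⟨a, b⟩ := p
  simp only [partner, depth, ne_eq] at *
  split_ifs at * <;> simp only [Prod.mk.injEq] at * <;> omega

/-- The generator with leading term `Z p`. -/
def generator (p : ℤ × ℤ) : V := Z p.1 p.2 + Z (partner p).1 (partner p).2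

/-- The coordinates of `Z p` with respect to the family `generator`. -/
def coords (p : ℤ × ℤ) : (ℤ × ℤ) →₀ ℚ :=
  if h : partner p = p then Finsupp.single p (1 / 2)
  else Finsupp.single p 1 - coords (partner p)
termination_by depth p
decreasing_by exact depth_partner_lt h

theorem coords_add_coords_partner (p : ℤ × ℤ) :
    coords p + coords (partner p) = Finsupp.single p 1 := by
  by_cases h : partner p = p
  · rw [h, coords, dif_pos h, ← Finsupp.single_add]
    norm_num
  · rw [coords, dif_neg h, sub_add_cancel]

/-- The linear map sending each `Z p` to `coords p`. -/
def coordMap : V →ₗ[ℚ] (ℤ × ℤ) →₀ ℚ :=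
  (Finsupp.linearCombination ℚ coords).comp (LinearMap.fst ℚ Xsp Ysp)

theorem coordMap_Z (a b : ℤ) : coordMap (Z a b) = coords (a, b) := by
  simp [coordMap, Z, XB, Phi, YB]

theorem linearIndependent_generator : LinearIndependent ℚ generator := by
  refine LinearIndependent.of_comp coordMap ?_
  have h : coordMap ∘ generator = fun p => Finsupp.single p 1 := by
    funext p
    simp [generator, coordMap_Z, coords_add_coords_partner]
  rw [h]
  exact Finsupp.linearIndependent_single_one ℚ (ℤ × ℤ)

theorem Z_mem_span_generator (p : ℤ × ℤ) :
    Z p.1 p.2 ∈ Submodule.span ℚ (Set.range generator) := by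
  have hg : generator p ∈ Submodule.span ℚ (Set.range generator) :=
    Submodule.subset_span ⟨p, rfl⟩
  by_cases h : partner p = p
  · have hZ : Z p.1 p.2 = (1 / 2 : ℚ) • generator p := by
      rw [generator, h]
      module
    rw [hZ]
    exact Submodule.smul_mem _ _ hg
  · have hZ : Z p.1 p.2 = generator p - Z (partner p).1 (partner p).2 := by
      rw [generator, add_sub_cancel_right]
    rw [hZ]
    exact Submodule.sub_mem _ hg (Z_mem_span_generator (partner p))
termination_by depth p
decreasing_by exact depth_partner_lt h

theorem span_generator : Submodule.span ℚ (Set.range generator) =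
    Submodule.span ℚ (Set.range (fun p : ℤ × ℤ => Z p.1 p.2)) := by
  apply le_antisymm <;> rw [Submodule.span_le] <;> rintro _ ⟨p, rfl⟩
  · exact Submodule.add_mem _ (Submodule.subset_span ⟨p, rfl⟩)
      (Submodule.subset_span ⟨partner p, rfl⟩)
  · exact Z_mem_span_generator p

theorem vJp_eq_Z_add_Z (a b : ℤ) : vJp a b = Z a b + Z b a := by
  simp only [vJp, Z, Phi, add_comm b a]
  module

theorem vJA_eq_Z_add_Z (a b : ℤ) : vJA a b = Z b (a + 1) + Z a (b + 1) := by
  have h₁ : b + (a + 1) = a + b + 1 := by ring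
  have h₂ : a + (b + 1) = a + b + 1 := by ring
  have h₃ : a + b + 1 - 2 = a + b - 1 := by ring
  have h₄ : a + b + 1 + 2 = a + b + 3 := by ring
  simp only [vJA, Z, Phi, h₁, h₂, h₃, h₄]
  push_cast
  module

/-- The index of the leading term of each `vJp` and `vJA`. -/
def leadingIndex : {p : ℤ × ℤ // p.2 ≤ p.1} ⊕ {p : ℤ × ℤ // p.2 ≤ p.1} → ℤ × ℤ :=
  Sum.elim (fun p => p.1) (fun p => (p.1.2, p.1.1 + 1))

theorem leadingIndex_injective : Function.Injective leadingIndex := by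
  rintro (⟨⟨a, b⟩, h⟩ | ⟨⟨a, b⟩, h⟩) (⟨⟨c, d⟩, h'⟩ | ⟨⟨c, d⟩, h'⟩) <;>
    simp only [leadingIndex, Sum.elim_inl, Sum.elim_inr, Prod.mk.injEq, Sum.inl.injEq,
      Sum.inr.injEq, Subtype.mk.injEq, reduceCtorEq] at * <;> omega

theorem leadingIndex_surjective : Function.Surjective leadingIndex := by
  rintro ⟨a, b⟩
  by_cases h : b ≤ a
  · exact ⟨Sum.inl ⟨(a, b), h⟩, rfl⟩
  · exact ⟨Sum.inr ⟨(b - 1, a), by dsimp only; omega⟩, by simp [leadingIndex]⟩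

theorem elim_vJp_vJA_eq_generator_comp :
    Sum.elim (fun p : {p : ℤ × ℤ // p.2 ≤ p.1} => vJp p.1.1 p.1.2)
      (fun p : {p : ℤ × ℤ // p.2 ≤ p.1} => vJA p.1.1 p.1.2) = generator ∘ leadingIndex := by
  funext i
  rcases i with ⟨⟨a, b⟩, h⟩ | ⟨⟨a, b⟩, h⟩ <;> dsimp only at h
  · simp [generator, leadingIndex, partner, h, vJp_eq_Z_add_Z]
  · have h' : ¬ a + 1 ≤ b := by omega
    simp [generator, leadingIndex, partner, h', vJA_eq_Z_add_Z]

theorem stmt4 :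
    LinearIndependent ℚ
      (Sum.elim (fun p : {p : ℤ × ℤ // p.2 ≤ p.1} => vJp p.1.1 p.1.2)
        (fun p : {p : ℤ × ℤ // p.2 ≤ p.1} => vJA p.1.1 p.1.2)) ∧
    Submodule.span ℚ
      (Set.range (Sum.elim (fun p : {p : ℤ × ℤ // p.2 ≤ p.1} => vJp p.1.1 p.1.2)
        (fun p : {p : ℤ × ℤ // p.2 ≤ p.1} => vJA p.1.1 p.1.2))) =
    Submodule.span ℚ (Set.range (fun p : ℤ × ℤ => Z p.1 p.2)) := by
  rw [elim_vJp_vJA_eq_generator_comp, leadingIndex_surjective.range_comp]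
  exact ⟨linearIndependent_generator.comp _ leadingIndex_injective, span_generator⟩
end
end

section
/- The family {vJ⁺(a,b) : (a,b) ∈ ℤ², a ≥ b} ∪ {vJᴬ(a,b) : (a,b) ∈ ℤ², a ≥ b} ∪ {vS(a) : a ∈ ℤ} is linearly independent in V, and its ℚ-linear span equals the subspace {v ∈ V : ψᵢ(v) = 0 for all i = 1,…,6}. -/
noncomputable section

/-- `vS(a) = -2·X_{0,a+1} - X_{-1,a} + X_{1,a} + 2·X_{0,a-1} - Y_{a+1} + Y_{a-1}`,
the `Z`-part of `F⁽¹⁾(S_{â,0,0})`. -/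
def vS (a : ℤ) : V :=
  -((2 : ℚ) • XB 0 (a + 1)) - XB (-1) a + XB 1 a + (2 : ℚ) • XB 0 (a - 1)
    - YB (a + 1) + YB (a - 1)

/-- The second difference `Y_{n-2} + Y_{n+2} - 2·Y_n`. -/
def secondDiff (n : ℤ) : Ysp :=
  Finsupp.single (n - 2) 1 + Finsupp.single (n + 2) 1 - (2 : ℚ) • Finsupp.single n 1

/-- The projection `V → Y` whose kernel is spanned by the vectors `vJp` and `vJA`. -/
def projY : V →ₗ[ℚ] Ysp :=
  (Finsupp.linearCombination ℚ (fun p : ℤ × ℤ =>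
      -Finsupp.single (p.1 + p.2) 1 + (((p.1 : ℚ) - p.2) / 2) • secondDiff (p.1 + p.2))).comp
    (LinearMap.fst ℚ Xsp Ysp) + LinearMap.snd ℚ Xsp Ysp

lemma projY_XB (a b : ℤ) :
    projY (XB a b) =
      -Finsupp.single (a + b) 1 + (((a : ℚ) - b) / 2) • secondDiff (a + b) := by
  simp [projY, XB]

lemma projY_YB (d : ℤ) : projY (YB d) = Finsupp.single d 1 := by
  simp [projY, YB]

lemma lmap_XB (gX : ℤ × ℤ → ℚ) (gY : ℤ → ℚ) (a b : ℤ) : lmap gX gY (XB a b) = gX (a, b) := by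
  simp [lmap, XB]

lemma lmap_YB (gX : ℤ × ℤ → ℚ) (gY : ℤ → ℚ) (d : ℤ) : lmap gX gY (YB d) = gY d := by
  simp [lmap, YB]

lemma projY_vJp (a b : ℤ) : projY (vJp a b) = 0 := by
  simp only [vJp, map_add, map_smul, projY_XB, projY_YB, add_comm b a]
  module

lemma projY_vJA (a b : ℤ) : projY (vJA a b) = 0 := by
  simp only [vJA, map_add, projY_XB, projY_YB, secondDiff]
  rw [show b + (a + 1) = a + b + 1 by ring, show a + (b + 1) = a + b + 1 by ring,
    show a + b + 1 - 2 = a + b - 1 by ring, show a + b + 1 + 2 = a + b + 3 by ring]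
  push_cast
  module

lemma two_smul_projY_vS (a : ℤ) :
    (2 : ℚ) • projY (vS a) =
      ((a : ℚ) + 3) • Finsupp.single (a + 3) 1 - (3 * ((a : ℚ) + 1)) • Finsupp.single (a + 1) 1
        + (3 * ((a : ℚ) - 1)) • Finsupp.single (a - 1) 1
        - ((a : ℚ) - 3) • Finsupp.single (a - 3) 1 := by
  simp only [vS, map_add, map_sub, map_neg, map_smul, projY_XB, projY_YB, secondDiff]
  rw [show 0 + (a + 1) = a + 1 by ring, show -1 + a = a - 1 by ring,
    show 1 + a = a + 1 by ring, show 0 + (a - 1) = a - 1 by ring,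
    show a + 1 - 2 = a - 1 by ring, show a + 1 + 2 = a + 3 by ring,
    show a - 1 - 2 = a - 3 by ring, show a - 1 + 2 = a + 1 by ring]
  push_cast
  module

/-- A functional on `V` factors through `projY` as soon as its values on the `X_{a,b}` are those
prescribed by its values on the `Y_d`. -/
lemma lmap_eq_comp_projY {gX : ℤ × ℤ → ℚ} {gY : ℤ → ℚ}
    (h : ∀ a b : ℤ, gX (a, b) = -gY (a + b) + ((a : ℚ) - b) / 2 *
      (gY (a + b - 2) + gY (a + b + 2) - 2 * gY (a + b))) :
    lmap gX gY = (Finsupp.linearCombination ℚ gY).comp projY := by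
  ext p
  · obtain ⟨a, b⟩ := p
    have h₁ := lmap_XB gX gY a b
    have h₂ := projY_XB a b
    simp only [XB] at h₁ h₂
    simp [h₁, h₂, h, secondDiff]
  · simp [lmap, projY]

/-- The values of `psi i` on the vectors `Y_d`. -/
def psiY : Fin 6 → ℤ → ℚ :=
  ![fun d => if Odd d then 1 else 0, fun d => if Even d then 1 else 0,
    fun d => if Odd d then (d : ℚ) else 0, fun d => if Even d then (d : ℚ) else 0,
    fun d => if Odd d then 1 / (d : ℚ) else 0, fun d => if d = 0 then 1 else 0]

lemma psi_eq_comp_projY (i : Fin 6) :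
    psi i = (Finsupp.linearCombination ℚ (psiY i)).comp projY := by
  have hsub (n : ℤ) : Odd (n - 2) ↔ Odd n := by grind
  have hadd (n : ℤ) : Odd (n + 2) ↔ Odd n := by grind
  fin_cases i <;> refine lmap_eq_comp_projY fun a b => ?_
  · by_cases h : Odd (a + b) <;> simp only [hsub, hadd, h, if_true, if_false] <;> ring
  · by_cases h : Odd (a + b) <;>
      simp only [← Int.not_odd_iff_even, hsub, hadd, h, not_true, not_false_iff, if_true,
        if_false] <;> ring
  · by_cases h : Odd (a + b) <;> simp only [hsub, hadd, h, if_true, if_false] <;> push_cast <;> ring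
  · by_cases h : Odd (a + b) <;>
      simp only [← Int.not_odd_iff_even, hsub, hadd, h, not_true, not_false_iff, if_true,
        if_false] <;> push_cast <;> ring
  · by_cases h : Odd (a + b) <;> simp only [hsub, hadd, h, if_true, if_false]
    · have h₀ : (a : ℚ) + b ≠ 0 := by
        have : a + b ≠ 0 := by grind
        exact_mod_cast this
      have h₁ : (a : ℚ) + b - 2 ≠ 0 := by
        have : a + b - 2 ≠ 0 := by grind
        exact_mod_cast this
      have h₂ : (a : ℚ) + b + 2 ≠ 0 := by
        have : a + b + 2 ≠ 0 := by grind
        exact_mod_cast this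
      push_cast
      rw [show ((a : ℚ) + b) ^ 2 - 4 = (a + b - 2) * (a + b + 2) by ring]
      field_simp
      ring
    · ring
  · simp only
    split_ifs <;> first | omega | ring

lemma third_diff_psiY (i : Fin 6) (a : ℤ) :
    ((a : ℚ) + 3) * psiY i (a + 3) - 3 * ((a : ℚ) + 1) * psiY i (a + 1)
      + 3 * ((a : ℚ) - 1) * psiY i (a - 1) - ((a : ℚ) - 3) * psiY i (a - 3) = 0 := by
  have h₁ : Odd (a + 3) ↔ ¬ Odd a := by grind
  have h₂ : Odd (a + 1) ↔ ¬ Odd a := by grind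
  have h₃ : Odd (a - 1) ↔ ¬ Odd a := by grind
  have h₄ : Odd (a - 3) ↔ ¬ Odd a := by grind
  have hinv (d : ℤ) (hd : Odd d) : (d : ℚ) * (d : ℚ)⁻¹ = 1 :=
    mul_inv_cancel₀ (Int.cast_ne_zero.2 (by grind))
  have hzero (d : ℤ) : (d : ℚ) * (if d = 0 then 1 else 0) = 0 := by aesop
  fin_cases i
  iterate 4
    by_cases h : Odd a <;> simp [psiY, ← Int.not_odd_iff_even, h₁, h₂, h₃, h₄, h] <;> ring
  · by_cases h : Odd a
    · simp [psiY, h₁, h₂, h₃, h₄, h]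
    · have e₁ := hinv _ (h₁.2 h)
      have e₂ := hinv _ (h₂.2 h)
      have e₃ := hinv _ (h₃.2 h)
      have e₄ := hinv _ (h₄.2 h)
      push_cast at e₁ e₂ e₃ e₄
      simp [psiY, h₁, h₂, h₃, h₄, h]
      linear_combination e₁ - 3 * e₂ + 3 * e₃ - e₄
  · have e₁ := hzero (a + 3)
    have e₂ := hzero (a + 1)
    have e₃ := hzero (a - 1)
    have e₄ := hzero (a - 3)
    push_cast at e₁ e₂ e₃ e₄
    change ((a : ℚ) + 3) * (if a + 3 = 0 then 1 else 0)
      - 3 * ((a : ℚ) + 1) * (if a + 1 = 0 then 1 else 0)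
      + 3 * ((a : ℚ) - 1) * (if a - 1 = 0 then 1 else 0)
      - ((a : ℚ) - 3) * (if a - 3 = 0 then 1 else 0) = 0
    linear_combination e₁ - 3 * e₂ + 3 * e₃ - e₄

lemma psi_vS (i : Fin 6) (a : ℤ) : psi i (vS a) = 0 := by
  have h : (2 : ℚ) * psi i (vS a) = 0 := by
    rw [psi_eq_comp_projY, LinearMap.comp_apply, ← smul_eq_mul, ← map_smul, two_smul_projY_vS]
    simp only [map_add, map_sub, map_smul, Finsupp.linearCombination_single, smul_eq_mul, one_mul]
    exact third_diff_psiY i a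
  linarith

/-- The family of all `vJp` and `vJA`. -/
def famJ : {p : ℤ × ℤ // p.2 ≤ p.1} ⊕ {p : ℤ × ℤ // p.2 ≤ p.1} → V :=
  Sum.elim (fun p => vJp p.1.1 p.1.2) (fun p => vJA p.1.1 p.1.2)

/-- Functionals dual to `famJ`. -/
def dualJ : {p : ℤ × ℤ // p.2 ≤ p.1} ⊕ {p : ℤ × ℤ // p.2 ≤ p.1} → Module.Dual ℚ V :=
  Sum.elim
    (fun p => lmap (fun q => if q.1 + q.2 = p.1.1 + p.1.2 then
        (if p.1.1 = p.1.2 then 1 / 2 else 1) *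
          (if q.2 ≤ q.1 ∧ p.1.1 - p.1.2 ≤ q.1 - q.2 then 1
            else if p.1.1 - p.1.2 < q.2 - q.1 then -1 else 0)
      else 0) 0)
    (fun p => lmap (fun q => if q.1 + q.2 = p.1.1 + p.1.2 + 1 then
        (if p.1.1 = p.1.2 then 1 / 2 else 1) *
          (if q.1 < q.2 ∧ p.1.1 - p.1.2 < q.2 - q.1 then 1
            else if p.1.1 - p.1.2 < q.1 - q.2 then -1 else 0)
      else 0) 0)

lemma linearIndependent_famJ : LinearIndependent ℚ famJ := by
  refine LinearIndependent.of_pairwise_dual_eq_zero_one famJ dualJ ?_ ?_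
  · rintro (⟨⟨a, b⟩, h⟩ | ⟨⟨a, b⟩, h⟩) (⟨⟨c, d⟩, h'⟩ | ⟨⟨c, d⟩, h'⟩) hne <;>
    simp only [famJ, dualJ, Sum.elim_inl, Sum.elim_inr, vJp, vJA, map_add, map_smul, lmap_XB,
      lmap_YB, Pi.zero_apply, smul_zero] <;>
    simp only [ne_eq, Sum.inl.injEq, Sum.inr.injEq, Subtype.mk.injEq, Prod.mk.injEq] at h h' hne <;>
    grind
  · rintro (⟨⟨a, b⟩, h⟩ | ⟨⟨a, b⟩, h⟩) <;>
    simp only [famJ, dualJ, Sum.elim_inl, Sum.elim_inr, vJp, vJA, map_add, map_smul, lmap_XB,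
      lmap_YB, Pi.zero_apply, smul_zero] <;>
    simp only at h <;> grind

/-- A function on `ℤ` vanishing at `0` whose third difference with step `2` is `δ_a`. -/
def thirdDiffInv (a d : ℤ) : ℚ :=
  if -3 < a then if Odd (d - a) ∧ 0 < d - a then (((d : ℚ) - a) ^ 2 - 1) / 8 else 0
  else if Odd (d - a) ∧ d - a < 0 then (1 - ((d : ℚ) - a) ^ 2) / 8 else 0

lemma thirdDiffInv_zero (a : ℤ) : thirdDiffInv a 0 = 0 := by
  unfold thirdDiffInv
  split_ifs with h₁ h₂ h₂
  · obtain rfl | rfl : a = -1 ∨ a = -2 := by omega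
    · norm_num
    · norm_num [Int.odd_iff] at h₂
  · rfl
  · omega
  · rfl

lemma third_diff_thirdDiffInv (a c : ℤ) :
    thirdDiffInv a (c + 3) - 3 * thirdDiffInv a (c + 1) + 3 * thirdDiffInv a (c - 1)
      - thirdDiffInv a (c - 3) = if a = c then 1 else 0 := by
  have h₁ : Odd (c + 3 - a) ↔ ¬ Odd (c - a) := by grind
  have h₂ : Odd (c + 1 - a) ↔ ¬ Odd (c - a) := by grind
  have h₃ : Odd (c - 1 - a) ↔ ¬ Odd (c - a) := by grind
  have h₄ : Odd (c - 3 - a) ↔ ¬ Odd (c - a) := by grind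
  simp only [thirdDiffInv, h₁, h₂, h₃, h₄]
  by_cases h : Odd (c - a)
  · have hac : a ≠ c := by grind
    simp [h, hac]
  obtain ⟨k, hk⟩ := Int.not_odd_iff_even.1 h
  obtain rfl : c = a + 2 * k := by omega
  simp only [h, not_false_iff, true_and]
  push_cast
  obtain hk | rfl | rfl | rfl | hk : k ≤ -2 ∨ k = -1 ∨ k = 0 ∨ k = 1 ∨ 2 ≤ k := by omega
  all_goals split_ifs <;> first | omega | (push_cast; ring)

lemma linearIndependent_projY_vS : LinearIndependent ℚ (projY ∘ vS) := by
  have key (a c : ℤ) : Finsupp.linearCombination ℚ (fun d : ℤ => 2 * thirdDiffInv a d / d)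
      (projY (vS c)) = if a = c then 1 else 0 := by
    have hd (d : ℤ) : (d : ℚ) * (2 * thirdDiffInv a d / d) = 2 * thirdDiffInv a d := by
      rcases eq_or_ne d 0 with rfl | hd
      · simp [thirdDiffInv_zero]
      · have : (d : ℚ) ≠ 0 := by exact_mod_cast hd
        field_simp
    have h : (2 : ℚ) * Finsupp.linearCombination ℚ (fun d : ℤ => 2 * thirdDiffInv a d / d)
        (projY (vS c)) = 2 * if a = c then 1 else 0 := by
      rw [← third_diff_thirdDiffInv, ← smul_eq_mul, ← map_smul, two_smul_projY_vS]
      have h₁ := hd (c + 3)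
      have h₂ := hd (c + 1)
      have h₃ := hd (c - 1)
      have h₄ := hd (c - 3)
      push_cast at h₁ h₂ h₃ h₄
      simp only [map_add, map_sub, map_smul, Finsupp.linearCombination_single, smul_eq_mul,
        one_mul]
      push_cast
      linear_combination h₁ - 3 * h₂ + 3 * h₃ - h₄
    linarith
  refine LinearIndependent.of_pairwise_dual_eq_zero_one _
    (fun a => Finsupp.linearCombination ℚ (fun d : ℤ => 2 * thirdDiffInv a d / d)) ?_ ?_
  · intro a c hne
    simpa [hne] using key a c
  · intro a
    simpa using key a a

lemma linearIndependent_sumElim_famJ_vS : LinearIndependent ℚ (Sum.elim famJ vS) := by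
  refine linearIndependent_famJ.sum_type (.of_comp projY linearIndependent_projY_vS) ?_
  refine ((Submodule.range_ker_disjoint linearIndependent_projY_vS).mono_right ?_).symm
  rw [Submodule.span_le, Set.range_subset_iff]
  rintro (p | p)
  · exact projY_vJp _ _
  · exact projY_vJA _ _

section Span

variable {K : Submodule ℚ V}

lemma XB_sub_mem (hp : ∀ a b, vJp a b ∈ K) (hA : ∀ a b, vJA a b ∈ K) (a b : ℤ) :
    XB a b - (0, projY (XB a b)) ∈ K := by
  set E : ℤ → ℤ → V := fun a b => XB a b - (0, projY (XB a b)) with hE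
  have hYB (d : ℤ) : ((0, Finsupp.single d 1) : V) = YB d := rfl
  have hEe (a b : ℤ) : E a b = XB a b + YB (a + b) - (((a : ℚ) - b) / 2) •
      (YB (a + b - 2) + YB (a + b + 2) - (2 : ℚ) • YB (a + b)) := by
    simp only [hE, projY_XB, secondDiff, YB]
    ext <;> simp
    ring
  have hstep (a b : ℤ) : E (a + 1) b - E a (b + 1) ∈ K := by
    have : E (a + 1) b - E a (b + 1) = vJp (a + 1) b - vJA a b := by
      simp only [hEe, vJp, vJA]
      rw [show a + 1 + b = a + b + 1 by ring, show a + (b + 1) = a + b + 1 by ring,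
        show a + b + 1 - 2 = a + b - 1 by ring, show a + b + 1 + 2 = a + b + 3 by ring]
      push_cast
      module
    rw [this]
    exact K.sub_mem (hp _ _) (hA _ _)
  have hall (n a : ℤ) : E a (n - a) - E 0 n ∈ K := by
    induction a using Int.induction_on with
    | zero => simp
    | succ k ih =>
      have := K.add_mem (hstep k (n - k - 1)) ih
      rw [show n - (k : ℤ) - 1 + 1 = n - k by ring] at this
      rw [show n - ((k : ℤ) + 1) = n - k - 1 by ring]
      simpa using this
    | pred k ih =>
      have := K.sub_mem ih (hstep (-k - 1) (n - -k))
      rw [show -(k : ℤ) - 1 + 1 = -k by ring] at this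
      rw [show n - (-(k : ℤ) - 1) = n - -k + 1 by ring]
      simpa using this
  have h₁ := hall (a + b) a
  have h₂ := hall (a + b) b
  rw [show a + b - a = b by ring] at h₁
  rw [show a + b - b = a by ring] at h₂
  have h₃ : E a b + E b a ∈ K := by
    have : E a b + E b a = vJp a b := by
      simp only [hEe, vJp, add_comm b a]
      module
    exact this ▸ hp a b
  have : E a b = (1 / 2 : ℚ) • (E a b + E b a +
      ((E a b - E 0 (a + b)) - (E b a - E 0 (a + b)))) := by
    module
  change E a b ∈ K
  rw [this]
  exact K.smul_mem _ (K.add_mem h₃ (K.sub_mem h₁ h₂))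

lemma sub_projY_mem (hp : ∀ a b, vJp a b ∈ K) (hA : ∀ a b, vJA a b ∈ K) (v : V) :
    v - (0, projY v) ∈ K := by
  have h : K.mkQ.comp (LinearMap.id - (LinearMap.inr ℚ Xsp Ysp).comp projY) = 0 := by
    ext p : 3
    · obtain ⟨a, b⟩ := p
      simpa [XB] using XB_sub_mem hp hA a b
    · simp [projY]
  exact (Submodule.Quotient.mk_eq_zero K).1 (LinearMap.congr_fun h v)

/-- The six vectors `Y_{-2}, …, Y_3` span `V` modulo the vectors `vJp`, `vJA` and `vS`. -/
lemma YB_mem_of_window (hp : ∀ a b, vJp a b ∈ K) (hA : ∀ a b, vJA a b ∈ K) (hS : ∀ a, vS a ∈ K)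
    (hw : ∀ d, -2 ≤ d → d ≤ 3 → YB d ∈ K) (d : ℤ) : YB d ∈ K := by
  have hrel (a : ℤ) : ((a : ℚ) + 3) • YB (a + 3) - (3 * ((a : ℚ) + 1)) • YB (a + 1)
      + (3 * ((a : ℚ) - 1)) • YB (a - 1) - ((a : ℚ) - 3) • YB (a - 3) ∈ K := by
    have h₁ := K.smul_mem (2 : ℚ) (K.sub_mem (hS a) (sub_projY_mem hp hA (vS a)))
    convert h₁ using 1
    have h₂ := congrArg (LinearMap.inr ℚ Xsp Ysp) (two_smul_projY_vS a)
    simp only [map_add, map_sub, map_smul, LinearMap.inr_apply] at h₂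
    rw [sub_sub_cancel, h₂]
    rfl
  have hmem (n : ℕ) : ∀ d : ℤ, -2 - n ≤ d → d ≤ 3 + n → YB d ∈ K := by
    induction n with
    | zero => simpa using hw
    | succ n ih =>
      intro d h₁ h₂
      push_cast at h₁ h₂
      by_cases hlo : d < -2 - n
      · have hr := hrel (d + 3)
        have ha := ih (d + 3 + 3) (by omega) (by omega)
        have hb := ih (d + 3 + 1) (by omega) (by omega)
        have hc := ih (d + 3 - 1) (by omega) (by omega)
        have hd : (d : ℚ) ≠ 0 := by
          have : d ≠ 0 := by omega
          exact_mod_cast this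
        rw [add_sub_cancel_right] at hr
        push_cast at hr
        rw [Submodule.sub_mem_iff_right _ (K.add_mem (K.sub_mem (K.smul_mem _ ha)
          (K.smul_mem _ hb)) (K.smul_mem _ hc)), add_sub_cancel_right] at hr
        exact (K.smul_mem_iff hd).1 hr
      by_cases hhi : 3 + n < d
      · have hr := hrel (d - 3)
        have ha := ih (d - 3 - 3) (by omega) (by omega)
        have hb := ih (d - 3 + 1) (by omega) (by omega)
        have hc := ih (d - 3 - 1) (by omega) (by omega)
        have hd : (d : ℚ) ≠ 0 := by
          have : d ≠ 0 := by omega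
          exact_mod_cast this
        rw [sub_add_cancel] at hr
        push_cast at hr
        rw [Submodule.sub_mem_iff_left _ (K.smul_mem _ ha),
          Submodule.add_mem_iff_left _ (K.smul_mem _ hc),
          Submodule.sub_mem_iff_left _ (K.smul_mem _ hb), sub_add_cancel] at hr
        exact (K.smul_mem_iff hd).1 hr
      · exact ih d (by omega) (by omega)
  exact hmem d.natAbs d (by omega) (by omega)

end Span

/-- A submodule of the common kernel of the `psi i` that contains every `vJp`, `vJA` and `vS` is
the whole common kernel. -/
lemma mem_of_psi_eq_zero {K : Submodule ℚ V} (hp : ∀ a b, vJp a b ∈ K) (hA : ∀ a b, vJA a b ∈ K)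
    (hS : ∀ a, vS a ∈ K) (hK : ∀ i, ∀ v ∈ K, psi i v = 0) {v : V} (hv : ∀ i, psi i v = 0) :
    v ∈ K := by
  let W : Submodule ℚ V := Submodule.span ℚ (Set.range fun j : Fin 6 => YB ((j : ℤ) - 2))
  have hY : ∀ d, YB d ∈ K ⊔ W := by
    refine YB_mem_of_window (fun a b => Submodule.mem_sup_left (hp a b))
      (fun a b => Submodule.mem_sup_left (hA a b)) (fun a => Submodule.mem_sup_left (hS a)) ?_
    intro d h₁ h₂
    refine Submodule.mem_sup_right (Submodule.subset_span ⟨⟨(d + 2).toNat, by omega⟩, ?_⟩)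
    change YB (((d + 2).toNat : ℤ) - 2) = YB d
    rw [Int.toNat_of_nonneg (by omega), add_sub_cancel_right]
  have hinr (y : Ysp) : ((0, y) : V) ∈ K ⊔ W := by
    induction y using Finsupp.induction_linear with
    | zero => exact zero_mem _
    | add f g hf hg => simpa using add_mem hf hg
    | single d c => simpa [YB] using (K ⊔ W).smul_mem c (hY d)
  have hvW : v ∈ K ⊔ W := by
    have := add_mem (Submodule.mem_sup_left (T := W) (sub_projY_mem hp hA v)) (hinr (projY v))
    simpa using this
  obtain ⟨k, hk, w, hw, rfl⟩ := Submodule.mem_sup.1 hvW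
  obtain ⟨c, rfl⟩ := (Submodule.mem_span_range_iff_exists_fun ℚ).1 hw
  have hpsi (i : Fin 6) : ∑ j, c j * psiY i ((j : ℤ) - 2) = 0 := by
    have h := hv i
    rw [map_add, hK i k hk, zero_add, map_sum] at h
    simpa [psi_eq_comp_projY, projY_YB] using h
  have hc : c = 0 := by
    have h₀ := hpsi 0
    have h₁ := hpsi 1
    have h₂ := hpsi 2
    have h₃ := hpsi 3
    have h₄ := hpsi 4
    have h₅ := hpsi 5
    simp [Fin.sum_univ_six, psiY, ← Int.not_even_iff_odd, Int.even_iff] at h₀ h₁ h₂ h₃ h₄ h₅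
    norm_num at h₂ h₃ h₄
    funext j
    fin_cases j <;> simp <;> linarith
  simpa [hc] using hk


theorem stmt8 :
    LinearIndependent ℚ
      (Sum.elim (fun p : {p : ℤ × ℤ // p.2 ≤ p.1} => vJp p.1.1 p.1.2)
        (Sum.elim (fun p : {p : ℤ × ℤ // p.2 ≤ p.1} => vJA p.1.1 p.1.2) vS)) ∧
    (Submodule.span ℚ
      (Set.range (Sum.elim (fun p : {p : ℤ × ℤ // p.2 ≤ p.1} => vJp p.1.1 p.1.2)
        (Sum.elim (fun p : {p : ℤ × ℤ // p.2 ≤ p.1} => vJA p.1.1 p.1.2) vS))) : Set V) =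
      {v : V | ∀ i : Fin 6, psi i v = 0} := by
  set F := Sum.elim (fun p : {p : ℤ × ℤ // p.2 ≤ p.1} => vJp p.1.1 p.1.2)
    (Sum.elim (fun p : {p : ℤ × ℤ // p.2 ≤ p.1} => vJA p.1.1 p.1.2) vS) with hF
  constructor
  · have h := linearIndependent_sumElim_famJ_vS.comp _ (Equiv.sumAssoc _ _ _).symm.injective
    convert h using 1
    ext x : 1
    rcases x with x | x | x <;> rfl
  have hp (a b : ℤ) : vJp a b ∈ Submodule.span ℚ (Set.range F) := by
    rcases le_total b a with h | h
    · exact Submodule.subset_span ⟨.inl ⟨(a, b), h⟩, rfl⟩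
    · rw [show vJp a b = vJp b a by simp only [vJp, add_comm b a]; abel]
      exact Submodule.subset_span ⟨.inl ⟨(b, a), h⟩, rfl⟩
  have hA (a b : ℤ) : vJA a b ∈ Submodule.span ℚ (Set.range F) := by
    rcases le_total b a with h | h
    · exact Submodule.subset_span ⟨.inr (.inl ⟨(a, b), h⟩), rfl⟩
    · rw [show vJA a b = vJA b a by simp only [vJA, add_comm b a]; abel]
      exact Submodule.subset_span ⟨.inr (.inl ⟨(b, a), h⟩), rfl⟩
  have hS (a : ℤ) : vS a ∈ Submodule.span ℚ (Set.range F) :=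
    Submodule.subset_span ⟨.inr (.inr a), rfl⟩
  have hK (i : Fin 6) : Submodule.span ℚ (Set.range F) ≤ LinearMap.ker (psi i) := by
    rw [Submodule.span_le, Set.range_subset_iff]
    rintro (p | p | a)
    · simp [hF, psi_eq_comp_projY, projY_vJp]
    · simp [hF, psi_eq_comp_projY, projY_vJA]
    · exact psi_vS i a
  ext v
  exact ⟨fun hv i => hK i hv, mem_of_psi_eq_zero hp hA hS fun i _ hv => hK i hv⟩
end
end
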